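/- Let S ∈ ℂ^{N×M} and let K ∈ ℂ^{M×M} be positive semidefinite with eigenvalue decomposition K = VΛV^H. Then det(I + S K S^H) ≤ det(I + ‖S‖_F² Λ), where ‖S‖_F is the Frobenius norm of S. -/

import Mathlib

open Matrix
open scoped ComplexOrder

section Hadamard

variable {𝕜 n : Type*} [RCLike 𝕜] [Fintype n] [DecidableEq n]

/-- A positive semidefinite matrix whose trace is at most its size has determinant at most one. -/
theorem Matrix.PosSemidef.re_det_le_one_of_re_trace_le_card {A : Matrix n n 𝕜}
    (hA : A.PosSemidef) (htr : RCLike.re A.trace ≤ Fintype.card n) : RCLike.re A.det ≤ 1 := by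
  have hsum : RCLike.re A.trace = ∑ i, hA.isHermitian.eigenvalues i := by
    rw [hA.isHermitian.trace_eq_sum_eigenvalues, ← RCLike.ofReal_sum, RCLike.ofReal_re]
  rw [hA.isHermitian.det_eq_prod_eigenvalues, ← RCLike.ofReal_prod, RCLike.ofReal_re]
  calc ∏ i, hA.isHermitian.eigenvalues i
      ≤ ∏ i, Real.exp (hA.isHermitian.eigenvalues i - 1) :=
        Finset.prod_le_prod (fun i _ => hA.eigenvalues_nonneg i) fun i _ => by
          linarith [Real.add_one_le_exp (hA.isHermitian.eigenvalues i - 1)]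
    _ ≤ 1 := by
        rw [← Real.exp_sum, Real.exp_le_one_iff, Finset.sum_sub_distrib, ← hsum]
        simpa using htr

/-- **Hadamard's inequality** for positive semidefinite matrices, with positive upper bounds on
the diagonal entries. -/
theorem Matrix.PosSemidef.re_det_le_prod {A : Matrix n n 𝕜} (hA : A.PosSemidef) {e : n → ℝ}
    (he : ∀ i, 0 < e i) (hAe : ∀ i, RCLike.re (A i i) ≤ e i) : RCLike.re A.det ≤ ∏ i, e i := by
  let E : Matrix n n 𝕜 := diagonal fun i => (((√(e i))⁻¹ : ℝ) : 𝕜)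
  have hE : Eᴴ = E := by
    simp only [E, diagonal_conjTranspose]
    congr 1
    ext i
    simp
  have hEAE : (E * A * E).PosSemidef := by
    simpa only [hE] using hA.conjTranspose_mul_mul_same E
  have hsq : ∀ i, (√(e i))⁻¹ * (√(e i))⁻¹ = (e i)⁻¹ := fun i => by
    rw [← mul_inv, Real.mul_self_sqrt (he i).le]
  have htr : RCLike.re (E * A * E).trace ≤ Fintype.card n := by
    have hentry : ∀ i, RCLike.re ((E * A * E) i i) ≤ 1 := fun i => by
      simp only [E, mul_diagonal, diagonal_mul]
      rw [mul_right_comm, ← RCLike.ofReal_mul, hsq, RCLike.re_ofReal_mul]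
      exact inv_mul_le_one_of_le₀ (hAe i) (he i).le
    simpa [trace] using Finset.sum_le_sum fun i (_ : i ∈ Finset.univ) => hentry i
  have hdet : (E * A * E).det = (((∏ i, e i)⁻¹ : ℝ) : 𝕜) * A.det := by
    rw [det_mul, det_mul, mul_right_comm, det_diagonal, ← RCLike.ofReal_prod, ← RCLike.ofReal_mul,
      ← Finset.prod_mul_distrib, ← Finset.prod_inv_distrib]
    simp only [hsq]
  have hle := hEAE.re_det_le_one_of_re_trace_le_card htr
  rwa [hdet, RCLike.re_ofReal_mul, inv_mul_le_one₀ (Finset.prod_pos fun i _ => he i)] at hle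

end Hadamard

theorem Matrix.conjTranspose_mul_self_apply_self {𝕜 m n : Type*} [RCLike 𝕜] [Fintype m]
    (A : Matrix m n 𝕜) (i : n) : (Aᴴ * A) i i = ((∑ a, ‖A a i‖ ^ 2 : ℝ) : 𝕜) := by
  simp [mul_apply, RCLike.conj_mul]

/-- The Frobenius norm is invariant under right multiplication by a unitary matrix. -/
theorem Matrix.sum_norm_sq_mul_of_mul_conjTranspose_eq_one {𝕜 m n : Type*} [RCLike 𝕜] [Fintype m]
    [Fintype n] [DecidableEq n] (A : Matrix m n 𝕜) {V : Matrix n n 𝕜} (hV : V * Vᴴ = 1) :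
    ∑ a, ∑ b, ‖(A * V) a b‖ ^ 2 = ∑ a, ∑ b, ‖A a b‖ ^ 2 := by
  have htrace : ∀ B : Matrix m n 𝕜, ((∑ a, ∑ b, ‖B a b‖ ^ 2 : ℝ) : 𝕜) = (Bᴴ * B).trace := by
    intro B
    rw [Finset.sum_comm, trace, RCLike.ofReal_sum]
    exact Finset.sum_congr rfl fun i _ => (B.conjTranspose_mul_self_apply_self i).symm
  apply RCLike.ofReal_injective (K := 𝕜)
  rw [htrace, htrace, conjTranspose_mul, Matrix.mul_assoc, trace_mul_comm, Matrix.mul_assoc,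
    Matrix.mul_assoc, hV, Matrix.mul_one]

/-- For `S ∈ ℂ^{N×M}` and positive semidefinite `K = V Λ Vᴴ` (with `V` unitary
and `Λ = diag(d)` having nonnegative real entries),
`det(I + S K Sᴴ) ≤ det(I + ‖S‖_F² Λ) = ∏ᵢ (1 + ‖S‖_F² dᵢ)`.
Since `I + S K Sᴴ` is positive semidefinite its determinant is real, and the
inequality is stated for its real part. -/
theorem det_one_add_SKSH_le (N M : ℕ) (S : Matrix (Fin N) (Fin M) ℂ)
    (K V : Matrix (Fin M) (Fin M) ℂ) (d : Fin M → ℝ) (hd : ∀ i, 0 ≤ d i)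
    (hV1 : Vᴴ * V = 1) (hV2 : V * Vᴴ = 1)
    (hK : K = V * Matrix.diagonal (fun i => (d i : ℂ)) * Vᴴ) :
    (1 + S * K * Sᴴ).det.re ≤ ∏ i, (1 + (∑ a, ∑ b, ‖S a b‖ ^ 2) * d i) := by
  let D : Matrix (Fin M) (Fin M) ℂ := diagonal fun i => ((√(d i) : ℝ) : ℂ)
  let W := S * V * D
  have hDD : D * Dᴴ = diagonal fun i => (d i : ℂ) := by
    simp only [D, diagonal_conjTranspose, diagonal_mul_diagonal]
    congr 1
    ext i
    simp [← Complex.ofReal_mul, Real.mul_self_sqrt (hd i)]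
  have hSKS : S * K * Sᴴ = W * Wᴴ := by
    simp only [hK, W, ← hDD, conjTranspose_mul, Matrix.mul_assoc]
  have hcol : ∀ i, ∑ a, ‖W a i‖ ^ 2 ≤ (∑ a, ∑ b, ‖S a b‖ ^ 2) * d i := fun i => by
    rw [← S.sum_norm_sq_mul_of_mul_conjTranspose_eq_one hV2, Finset.sum_mul]
    refine Finset.sum_le_sum fun a _ => ?_
    have hW : ‖W a i‖ ^ 2 = ‖(S * V) a i‖ ^ 2 * d i := by
      simp only [W, D, mul_diagonal, norm_mul, Complex.norm_real, mul_pow, Real.norm_eq_abs,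
        sq_abs, Real.sq_sqrt (hd i)]
    rw [hW]
    exact mul_le_mul_of_nonneg_right (Finset.single_le_sum (f := fun b => ‖(S * V) a b‖ ^ 2)
      (fun b _ => sq_nonneg _) (Finset.mem_univ i)) (hd i)
  rw [hSKS, det_one_add_mul_comm]
  refine (PosSemidef.one.add (posSemidef_conjTranspose_mul_self W)).re_det_le_prod
    (fun i => ?_) fun i => ?_
  · have := hd i
    positivity
  · rw [Matrix.add_apply, one_apply_eq, conjTranspose_mul_self_apply_self, map_add, RCLike.one_re,
      RCLike.ofReal_re]
    exact add_le_add_right (hcol i) 1
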